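/- There exist universal constants c > 0 and C > 0 with the following property. Let d, r be positive integers, u_1, …, u_r ∈ ℝ^d nonzero vectors, μ ≥ 1, T⋆ = Σ_{i=1}^r u_i^{⊗3}, and U⋆ = [u_1, …, u_r] ∈ ℝ^{d×r}. Assume d‖u_i‖_∞² ≤ μ‖u_i‖₂² for every i, d⟨u_i, u_j⟩² ≤ μ‖u_i‖₂²‖u_j‖₂² for all i ≠ j, and r·√(μ/d) ≤ c·(λ_min⋆/λ_max⋆)². If 0 ≤ δ ≤ c/r and U' = [u'_1, …, u'_r] ∈ ℝ^{d×r} satisfies ‖U' − U⋆‖_{2,∞} ≤ δ‖U⋆‖_{2,∞} and ‖U' − U⋆‖_F ≤ δ‖U⋆‖_F, then T = Σ_{i=1}^r (u'_i)^{⊗3} satisfies ‖T − T⋆‖_∞ ≤ C·(λ_max⋆/λ_min⋆)·δ·√(μ³ r)·‖T⋆‖_∞. -/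

import Mathlib

open MeasureTheory ProbabilityTheory

noncomputable section

/-- Euclidean (ℓ₂) norm of a vector in ℝ^d. -/
def l2norm {d : ℕ} (u : Fin d → ℝ) : ℝ := Real.sqrt (∑ j, u j ^ 2)

/-- ℓ∞ norm of a vector in ℝ^d. -/
def linfnorm {d : ℕ} (u : Fin d → ℝ) : ℝ := ⨆ j, |u j|

/-- Euclidean inner product on ℝ^d. -/
def inp {d : ℕ} (u v : Fin d → ℝ) : ℝ := ∑ j, u j * v j

/-- The symmetric tensor T⋆ = Σᵢ uᵢ^{⊗3}, with entries T⋆_{j,k,l} = Σᵢ (uᵢ)_j (uᵢ)_k (uᵢ)_l. -/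
def Tstar {d r : ℕ} (u : Fin r → Fin d → ℝ) : Fin d → Fin d → Fin d → ℝ :=
  fun j k l => ∑ i, u i j * u i k * u i l

/-- Frobenius norm of a d×d×d tensor. -/
def frobT {d : ℕ} (T : Fin d → Fin d → Fin d → ℝ) : ℝ :=
  Real.sqrt (∑ j, ∑ k, ∑ l, T j k l ^ 2)

/-- ℓ∞ (entrywise max) norm of a d×d×d tensor. -/
def tinf {d : ℕ} (T : Fin d → Fin d → Fin d → ℝ) : ℝ := ⨆ j, ⨆ k, ⨆ l, |T j k l|

/-- λ_max⋆ = maxᵢ ‖uᵢ‖₂³. -/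
def lamMax {d r : ℕ} (u : Fin r → Fin d → ℝ) : ℝ := ⨆ i, l2norm (u i) ^ 3

/-- λ_min⋆ = minᵢ ‖uᵢ‖₂³. -/
def lamMin {d r : ℕ} (u : Fin r → Fin d → ℝ) : ℝ := ⨅ i, l2norm (u i) ^ 3

/-- Frobenius norm of the d×r matrix whose i-th column is u i. -/
def frobM {d r : ℕ} (U : Fin r → Fin d → ℝ) : ℝ :=
  Real.sqrt (∑ i, ∑ j, U i j ^ 2)

/-- ‖·‖_{2,∞}: maximum ℓ₂ norm of the rows of the d×r matrix whose i-th column is u i. -/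
def m2inf {d r : ℕ} (U : Fin r → Fin d → ℝ) : ℝ :=
  ⨆ j : Fin d, Real.sqrt (∑ i, U i j ^ 2)

/-- Tensor operator norm: sup of ⟨T, a⊗b⊗c⟩ over unit vectors a, b, c. -/
def topNorm {d : ℕ} (T : Fin d → Fin d → Fin d → ℝ) : ℝ :=
  sSup {x : ℝ | ∃ a b c : Fin d → ℝ,
    l2norm a = 1 ∧ l2norm b = 1 ∧ l2norm c = 1 ∧
    x = ∑ j, ∑ k, ∑ l, T j k l * a j * b k * c l}

/-- Matrix spectral (ℓ₂→ℓ₂ operator) norm: sup of ‖Mv‖₂ over unit vectors v. -/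
def specNorm {m n : ℕ} (M : Matrix (Fin m) (Fin n) ℝ) : ℝ :=
  sSup {x : ℝ | ∃ v : Fin n → ℝ, l2norm v = 1 ∧ x = l2norm (M.mulVec v)}

end


lemma frob_expand {d r : ℕ} (u : Fin r → Fin d → ℝ) :
    ∑ j, ∑ k, ∑ l, Tstar u j k l ^ 2 = ∑ i, ∑ i', inp (u i) (u i') ^ 3 := by
  have h1 : ∀ i i', inp (u i) (u i') ^ 3
      = ∑ j, ∑ k, ∑ l, (u i j * u i k * u i l) * (u i' j * u i' k * u i' l) := by
    intro i i'
    have : inp (u i) (u i') ^ 3 = inp (u i) (u i') * (inp (u i) (u i') * inp (u i) (u i')) := by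
      ring
    rw [this]
    unfold inp
    rw [Finset.sum_mul_sum, Finset.sum_mul_sum]
    refine Finset.sum_congr rfl fun j _ => ?_
    refine Finset.sum_congr rfl fun k _ => ?_
    rw [Finset.mul_sum]
    refine Finset.sum_congr rfl fun l _ => ?_
    ring
  simp_rw [h1]
  have h2 : ∀ j k l, Tstar u j k l ^ 2
      = ∑ i, ∑ i', (u i j * u i k * u i l) * (u i' j * u i' k * u i' l) := by
    intro j k l
    rw [sq]
    unfold Tstar
    rw [Finset.sum_mul_sum]
  simp_rw [h2]
  calc _ = ∑ j, ∑ k, ∑ i, ∑ l, ∑ i', (u i j * u i k * u i l) * (u i' j * u i' k * u i' l) := by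
        refine Finset.sum_congr rfl fun j _ => Finset.sum_congr rfl fun k _ => ?_
        rw [Finset.sum_comm]
    _ = ∑ j, ∑ i, ∑ k, ∑ l, ∑ i', (u i j * u i k * u i l) * (u i' j * u i' k * u i' l) := by
        refine Finset.sum_congr rfl fun j _ => ?_
        rw [Finset.sum_comm]
    _ = ∑ i, ∑ j, ∑ k, ∑ l, ∑ i', (u i j * u i k * u i l) * (u i' j * u i' k * u i' l) := by
        rw [Finset.sum_comm]
    _ = _ := by
        refine Finset.sum_congr rfl fun i _ => ?_
        calc _ = ∑ j, ∑ k, ∑ i', ∑ l, (u i j * u i k * u i l) * (u i' j * u i' k * u i' l) := by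
              refine Finset.sum_congr rfl fun j _ => Finset.sum_congr rfl fun k _ => ?_
              rw [Finset.sum_comm]
          _ = ∑ j, ∑ i', ∑ k, ∑ l, (u i j * u i k * u i l) * (u i' j * u i' k * u i' l) := by
              refine Finset.sum_congr rfl fun j _ => ?_
              rw [Finset.sum_comm]
          _ = _ := by
              rw [Finset.sum_comm]

lemma abs_sum3 {r : ℕ} (x y z : Fin r → ℝ) (X Y Z : ℝ) (hX : 0 ≤ X) (hY : 0 ≤ Y)
    (hZ : 0 ≤ Z) (hx : ∑ i, x i ^ 2 ≤ X ^ 2) (hy : ∑ i, y i ^ 2 ≤ Y ^ 2) (hz : ∀ i, |z i| ≤ Z) :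
    |∑ i, x i * y i * z i| ≤ X * Y * Z := by
  have h1 : ∑ i, |x i| * |y i| ≤ X * Y := by
    have := Finset.sum_mul_sq_le_sq_mul_sq Finset.univ (fun i => |x i|) (fun i => |y i|)
    simp only [sq_abs] at this
    refine abs_le_of_sq_le_sq' ?_ (by positivity) |>.2
    refine this.trans ?_
    rw [mul_pow]
    exact mul_le_mul hx hy (Finset.sum_nonneg fun _ _ => sq_nonneg _) (sq_nonneg _)
  calc |∑ i, x i * y i * z i| ≤ ∑ i, |x i * y i * z i| := Finset.abs_sum_le_sum_abs _ _
    _ ≤ ∑ i, |x i| * |y i| * Z := by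
        refine Finset.sum_le_sum fun i _ => ?_
        rw [abs_mul, abs_mul]
        exact mul_le_mul_of_nonneg_left (hz i) (by positivity)
    _ = (∑ i, |x i| * |y i|) * Z := by rw [Finset.sum_mul]
    _ ≤ X * Y * Z := mul_le_mul_of_nonneg_right h1 hZ

lemma le_tinf {d : ℕ} (T : Fin d → Fin d → Fin d → ℝ) (j k l : Fin d) : |T j k l| ≤ tinf T := by
  unfold tinf
  refine (le_ciSup (f := fun l => |T j k l|) (Set.finite_range _).bddAbove l).trans ?_
  refine (le_ciSup (f := fun k => ⨆ l, |T j k l|) (Set.finite_range _).bddAbove k).trans ?_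
  exact le_ciSup (f := fun j => ⨆ k, ⨆ l, |T j k l|) (Set.finite_range _).bddAbove j

lemma tinf_lower {d r : ℕ} (u : Fin r → Fin d → ℝ) (s L : ℝ) (hd : 0 < d)
    (hs : 0 ≤ s) (hL : 0 ≤ L) (hrs : (r : ℝ) * s ≤ 1 / 2) (hs1 : s ≤ 1 / 2)
    (hl : ∀ i, L ≤ l2norm (u i) ^ 3)
    (hin : ∀ i j, i ≠ j → |inp (u i) (u j)| ≤ s * l2norm (u i) * l2norm (u j)) :
    Real.sqrt r * L / 2 ≤ Real.sqrt ((d : ℝ) ^ 3) * tinf (Tstar u) := by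
  have ht : 0 ≤ tinf (Tstar u) := (abs_nonneg _).trans (le_tinf _ ⟨0, hd⟩ ⟨0, hd⟩ ⟨0, hd⟩)
  have hn : ∀ i, 0 ≤ l2norm (u i) := fun i => Real.sqrt_nonneg _
  have up : ∑ j, ∑ k, ∑ l, Tstar u j k l ^ 2 ≤ (d : ℝ) ^ 3 * tinf (Tstar u) ^ 2 := by
    calc _ ≤ ∑ j : Fin d, ∑ k : Fin d, ∑ l : Fin d, tinf (Tstar u) ^ 2 := by
          refine Finset.sum_le_sum fun j _ => Finset.sum_le_sum fun k _ =>
            Finset.sum_le_sum fun l _ => ?_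
          exact sq_le_sq' (abs_le.1 (le_tinf (Tstar u) j k l)).1 (abs_le.1 (le_tinf (Tstar u) j k l)).2
      _ = _ := by
          simp
          ring
  have self : ∀ i, inp (u i) (u i) = l2norm (u i) ^ 2 := by
    intro i
    unfold inp l2norm
    rw [Real.sq_sqrt (Finset.sum_nonneg fun _ _ => sq_nonneg _)]
    exact Finset.sum_congr rfl fun _ _ => by ring
  have s3 : s ^ 3 ≤ s / 4 := by nlinarith [mul_nonneg hs (sub_nonneg.2 hs1), mul_nonneg (mul_nonneg hs hs) (sub_nonneg.2 hs1)]
  have pt : ∀ i i', (if i = i' then (l2norm (u i) ^ 3) ^ 2 else 0)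
      - s / 4 * (l2norm (u i) ^ 3 * l2norm (u i') ^ 3) ≤ inp (u i) (u i') ^ 3 := by
    intro i i'
    have h0 := hn i
    have h0' := hn i'
    split_ifs with h
    · subst h
      rw [self]
      have : 0 ≤ s / 4 * (l2norm (u i) ^ 3 * l2norm (u i) ^ 3) := by positivity
      nlinarith
    · have h1 := pow_le_pow_left₀ (abs_nonneg _) (hin i i' h) 3
      rw [← abs_pow] at h1
      have h2 := (abs_le.1 h1).1
      have h3 : s ^ 3 * (l2norm (u i) ^ 3 * l2norm (u i') ^ 3)
          ≤ s / 4 * (l2norm (u i) ^ 3 * l2norm (u i') ^ 3) :=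
        mul_le_mul_of_nonneg_right s3 (by positivity)
      nlinarith
  have low : (r : ℝ) * L ^ 2 / 4 ≤ ∑ i, ∑ i', inp (u i) (u i') ^ 3 := by
    have e1 : ∑ i, ∑ i', ((if i = i' then (l2norm (u i) ^ 3) ^ 2 else 0)
      - s / 4 * (l2norm (u i) ^ 3 * l2norm (u i') ^ 3)) ≤ ∑ i, ∑ i', inp (u i) (u i') ^ 3 :=
      Finset.sum_le_sum fun i _ => Finset.sum_le_sum fun i' _ => pt i i'
    have e2 : ∑ i, ∑ i', ((if i = i' then (l2norm (u i) ^ 3) ^ 2 else 0)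
      - s / 4 * (l2norm (u i) ^ 3 * l2norm (u i') ^ 3))
      = ∑ i, (l2norm (u i) ^ 3) ^ 2 - s / 4 * (∑ i, l2norm (u i) ^ 3) ^ 2 := by
      rw [sq (∑ i, l2norm (u i) ^ 3), Finset.sum_mul_sum, Finset.mul_sum, ← Finset.sum_sub_distrib]
      refine Finset.sum_congr rfl fun i _ => ?_
      rw [Finset.mul_sum, Finset.sum_sub_distrib]
      simp
    have e3 : (∑ i, l2norm (u i) ^ 3) ^ 2 ≤ r * ∑ i, (l2norm (u i) ^ 3) ^ 2 := by
      have := sq_sum_le_card_mul_sum_sq (s := Finset.univ) (f := fun i => l2norm (u i) ^ 3)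
      simpa using this
    have e4 : (r : ℝ) * L ^ 2 ≤ ∑ i, (l2norm (u i) ^ 3) ^ 2 := by
      calc (r : ℝ) * L ^ 2 = ∑ i : Fin r, L ^ 2 := by simp
        _ ≤ _ := Finset.sum_le_sum fun i _ => pow_le_pow_left₀ hL (hl i) 2
    have e5 : 0 ≤ ∑ i, (l2norm (u i) ^ 3) ^ 2 := Finset.sum_nonneg fun _ _ => sq_nonneg _
    rw [e2] at e1
    have e6 := mul_le_mul_of_nonneg_left e3 (by positivity : 0 ≤ s / 4)
    have e7 := mul_le_mul_of_nonneg_right hrs e5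
    nlinarith
  rw [← frob_expand] at low
  refine abs_le_of_sq_le_sq' ?_ (by positivity) |>.2
  rw [mul_pow, Real.sq_sqrt (by positivity), div_pow, mul_pow, Real.sq_sqrt (by positivity)]
  linarith

/-- Entrywise stability of U ↦ Σᵢ uᵢ^{⊗3}: there are universal constants
c, C > 0 such that if ‖U' − U⋆‖_{2,∞} ≤ δ‖U⋆‖_{2,∞} and ‖U' − U⋆‖_F ≤ δ‖U⋆‖_F with δ ≤ c/r,
then ‖T − T⋆‖_∞ ≤ C·(λ_max⋆/λ_min⋆)·δ·√(μ³r)·‖T⋆‖_∞. -/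
theorem stmt8 : ∃ c C : ℝ, 0 < c ∧ 0 < C ∧
    ∀ (d r : ℕ), 0 < d → 0 < r →
    ∀ (u : Fin r → Fin d → ℝ), (∀ i, u i ≠ 0) →
    ∀ (μ : ℝ), 1 ≤ μ →
    (∀ i, (d : ℝ) * linfnorm (u i) ^ 2 ≤ μ * l2norm (u i) ^ 2) →
    (∀ i j : Fin r, i ≠ j →
      (d : ℝ) * inp (u i) (u j) ^ 2 ≤ μ * l2norm (u i) ^ 2 * l2norm (u j) ^ 2) →
    (r : ℝ) * Real.sqrt (μ / d) ≤ c * (lamMin u / lamMax u) ^ 2 →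
    ∀ (δ : ℝ), 0 ≤ δ → δ ≤ c / r →
    ∀ (u' : Fin r → Fin d → ℝ),
    m2inf (fun i j => u' i j - u i j) ≤ δ * m2inf u →
    frobM (fun i j => u' i j - u i j) ≤ δ * frobM u →
    tinf (fun j k l => Tstar u' j k l - Tstar u j k l) ≤
      C * (lamMax u / lamMin u) * δ * Real.sqrt (μ ^ 3 * r) * tinf (Tstar u) := by
  refine ⟨1 / 2, 14, by norm_num, by norm_num, ?_⟩
  intro d r hd hr u hu μ hμ hinf hinc hrs δ hδ0 hδ u' h2 _
  have : Nonempty (Fin r) := ⟨⟨0, hr⟩⟩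
  have : Nonempty (Fin d) := ⟨⟨0, hd⟩⟩
  have hd' : (0 : ℝ) < d := by exact_mod_cast hd
  have hr' : (1 : ℝ) ≤ r := by exact_mod_cast hr
  have hn : ∀ i, 0 ≤ l2norm (u i) := fun i => Real.sqrt_nonneg _
  have hmax : ∀ i, l2norm (u i) ^ 3 ≤ lamMax u := fun i =>
    le_ciSup (f := fun i => l2norm (u i) ^ 3) (Set.finite_range _).bddAbove i
  have hmin : ∀ i, lamMin u ≤ l2norm (u i) ^ 3 := fun i =>
    ciInf_le (f := fun i => l2norm (u i) ^ 3) (Set.finite_range _).bddBelow i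
  have hpos : ∀ i, 0 < l2norm (u i) := by
    intro i
    refine Real.sqrt_pos.2 ?_
    obtain ⟨j, hj⟩ := Function.ne_iff.1 (hu i)
    have hj' : u i j ≠ 0 := hj
    exact Finset.sum_pos' (fun _ _ => sq_nonneg _) ⟨j, Finset.mem_univ _, by positivity⟩
  have hmpos : 0 < lamMin u := by
    obtain ⟨i, hi⟩ := exists_eq_ciInf_of_finite (f := fun i => l2norm (u i) ^ 3)
    have : lamMin u = l2norm (u i) ^ 3 := hi.symm
    rw [this]
    exact pow_pos (hpos i) 3
  have hmM : lamMin u ≤ lamMax u := (hmin ⟨0, hr⟩).trans (hmax _)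
  have hMpos : 0 < lamMax u := hmpos.trans_le hmM
  obtain ⟨i0, hi0⟩ := Finite.exists_max (fun i => l2norm (u i))
  set A := l2norm (u i0) with hA
  have hA0 : 0 ≤ A := hn i0
  have hAM : A ^ 3 ≤ lamMax u := hmax i0
  set s := Real.sqrt (μ / d) with hs
  have hs0 : 0 ≤ s := Real.sqrt_nonneg _
  have hs2 : s ^ 2 * d = μ := by
    rw [hs, Real.sq_sqrt (by positivity)]
    field_simp
  have hrs' : (r : ℝ) * s ≤ 1 / 2 := by
    have h1 : lamMin u / lamMax u ≤ 1 := (div_le_one hMpos).2 hmM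
    have h2 : (lamMin u / lamMax u) ^ 2 ≤ 1 := pow_le_one₀ (by positivity) h1
    linarith
  have hs1 : s ≤ 1 / 2 := by nlinarith
  have hin : ∀ i j, i ≠ j → |inp (u i) (u j)| ≤ s * l2norm (u i) * l2norm (u j) := by
    intro i j hij
    have h0 := hn i
    have h0' := hn j
    refine abs_le_of_sq_le_sq ?_ (by positivity)
    have := hinc i j hij
    rw [← hs2] at this
    nlinarith
  have key := tinf_lower u s (lamMin u) hd hs0 hmpos.le hrs' hs1 hmin hin
  have hent : ∀ i j, |u i j| ≤ s * A := by
    intro i j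
    have h1 : |u i j| ≤ linfnorm (u i) :=
      le_ciSup (f := fun j => |u i j|) (Set.finite_range _).bddAbove j
    have h2 : linfnorm (u i) ≤ s * l2norm (u i) := by
      have h0 := hn i
      refine abs_le_of_sq_le_sq' ?_ (by positivity) |>.2
      have := hinf i
      rw [← hs2] at this
      nlinarith
    exact h1.trans (h2.trans (mul_le_mul_of_nonneg_left (hi0 i) hs0))
  set p := Real.sqrt r with hp
  have hp0 : 0 ≤ p := Real.sqrt_nonneg _
  have hp2 : p ^ 2 = r := Real.sq_sqrt (by positivity)
  have hp1 : 1 ≤ p := by nlinarith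
  set m := s * A with hm
  have hm0 : 0 ≤ m := mul_nonneg hs0 hA0
  have hrow : ∀ j, ∑ i, u i j ^ 2 ≤ (p * m) ^ 2 := by
    intro j
    calc ∑ i, u i j ^ 2 ≤ ∑ i : Fin r, m ^ 2 := by
          refine Finset.sum_le_sum fun i _ => ?_
          exact sq_le_sq' (abs_le.1 (hent i j)).1 (abs_le.1 (hent i j)).2
      _ = (p * m) ^ 2 := by
          rw [mul_pow p m, hp2]
          simp
  have hM : m2inf u ≤ p * m := by
    refine ciSup_le fun j => ?_
    exact Real.sqrt_le_iff.2 ⟨by positivity, hrow j⟩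
  have hD : ∀ j, ∑ i, (u' i j - u i j) ^ 2 ≤ (δ * (p * m)) ^ 2 := by
    intro j
    have h1 : Real.sqrt (∑ i, (u' i j - u i j) ^ 2) ≤ m2inf (fun i j => u' i j - u i j) :=
      le_ciSup (f := fun j => Real.sqrt (∑ i, (u' i j - u i j) ^ 2)) (Set.finite_range _).bddAbove j
    have h3 := h1.trans (h2.trans (mul_le_mul_of_nonneg_left hM hδ0))
    exact (Real.sqrt_le_iff.1 h3).2
  have hDe : ∀ i j, |u' i j - u i j| ≤ δ * (p * m) := by
    intro i j
    refine abs_le_of_sq_le_sq ?_ (by positivity)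
    refine le_trans ?_ (hD j)
    exact Finset.single_le_sum (f := fun i => (u' i j - u i j) ^ 2) (fun _ _ => sq_nonneg _)
      (Finset.mem_univ i)
  have hδp : δ * p ≤ 1 / 2 := by
    have h1 : δ * r ≤ 1 / 2 := by
      rw [le_div_iff₀ (by positivity)] at hδ
      exact hδ
    have h3 : δ * p ≤ δ * r := mul_le_mul_of_nonneg_left (by nlinarith) hδ0
    linarith
  have hδ1 : δ ≤ 1 := by nlinarith
  have main : tinf (fun j k l => Tstar u' j k l - Tstar u j k l) ≤ 7 * δ * (p ^ 2 * m ^ 3) := by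
    refine ciSup_le fun j => ciSup_le fun k => ciSup_le fun l => ?_
    have hE : 0 ≤ δ * (p * m) := by positivity
    have hF : 0 ≤ p * m := by positivity
    let D : Fin d → Fin r → ℝ := fun j i => u' i j - u i j
    let V : Fin d → Fin r → ℝ := fun j i => u i j
    have t1 := abs_sum3 (D j) (V k) (V l) _ _ _ hE hF hm0 (hD j) (hrow k) (fun i => hent i l)
    have t2 := abs_sum3 (D k) (V j) (V l) _ _ _ hE hF hm0 (hD k) (hrow j) (fun i => hent i l)
    have t3 := abs_sum3 (D l) (V j) (V k) _ _ _ hE hF hm0 (hD l) (hrow j) (fun i => hent i k)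
    have t4 := abs_sum3 (D j) (D k) (V l) _ _ _ hE hE hm0 (hD j) (hD k) (fun i => hent i l)
    have t5 := abs_sum3 (D j) (D l) (V k) _ _ _ hE hE hm0 (hD j) (hD l) (fun i => hent i k)
    have t6 := abs_sum3 (D k) (D l) (V j) _ _ _ hE hE hm0 (hD k) (hD l) (fun i => hent i j)
    have t7 := abs_sum3 (D j) (D k) (D l) _ _ _ hE hE hE (hD j) (hD k) (fun i => hDe i l)
    have eq : Tstar u' j k l - Tstar u j k l
        = ∑ i, D j i * V k i * V l i + ∑ i, D k i * V j i * V l i + ∑ i, D l i * V j i * V k i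
        + ∑ i, D j i * D k i * V l i + ∑ i, D j i * D l i * V k i + ∑ i, D k i * D l i * V j i
        + ∑ i, D j i * D k i * D l i := by
      unfold Tstar
      simp only [← Finset.sum_add_distrib, ← Finset.sum_sub_distrib]
      refine Finset.sum_congr rfl fun i _ => ?_
      simp only [D, V]
      ring
    have hQ : 0 ≤ δ * (p ^ 2 * m ^ 3) := by positivity
    have b1 : δ * (p * m) * (p * m) * m = δ * (p ^ 2 * m ^ 3) := by ring
    have b2 : δ * (p * m) * (δ * (p * m)) * m ≤ δ * (p ^ 2 * m ^ 3) := by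
      have : δ * (p * m) * (δ * (p * m)) * m = δ * (δ * (p ^ 2 * m ^ 3)) := by ring
      rw [this]
      exact mul_le_of_le_one_left hQ hδ1
    have b3 : δ * (p * m) * (δ * (p * m)) * (δ * (p * m)) ≤ δ * (p ^ 2 * m ^ 3) := by
      have : δ * (p * m) * (δ * (p * m)) * (δ * (p * m))
          = (δ * (δ * p)) * (δ * (p ^ 2 * m ^ 3)) := by ring
      rw [this]
      refine mul_le_of_le_one_left hQ ?_
      exact mul_le_one₀ hδ1 (by positivity) (by linarith)
    rw [b1] at t1 t2 t3
    have t4' := t4.trans b2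
    have t5' := t5.trans b2
    have t6' := t6.trans b2
    have t7' := t7.trans b3
    show |Tstar u' j k l - Tstar u j k l| ≤ _
    rw [eq]
    rw [abs_le] at *
    constructor <;> linarith [t1.1, t1.2, t2.1, t2.2, t3.1, t3.2, t4'.1, t4'.2, t5'.1, t5'.2,
      t6'.1, t6'.2, t7'.1, t7'.2]
  refine main.trans ?_
  have hsq : Real.sqrt (μ ^ 3 * r) = s ^ 3 * Real.sqrt ((d : ℝ) ^ 3) * p := by
    rw [Real.sqrt_mul (by positivity), ← hs2, mul_pow, Real.sqrt_mul (by positivity)]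
    congr 2
    rw [← pow_mul, mul_comm 2 3, pow_mul, Real.sqrt_sq (by positivity)]
  rw [hsq]
  have f1 : s ^ 3 * p * (p * lamMin u / 2) ≤ s ^ 3 * p * (Real.sqrt ((d : ℝ) ^ 3) * tinf (Tstar u)) :=
    mul_le_mul_of_nonneg_left key (by positivity)
  have f2 := mul_le_mul_of_nonneg_left f1
    (by positivity : 0 ≤ 14 * (lamMax u / lamMin u) * δ)
  have f3 : 14 * (lamMax u / lamMin u) * δ * (s ^ 3 * p * (p * lamMin u / 2))
      = 7 * δ * (p ^ 2 * (s ^ 3 * lamMax u)) := by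
    field_simp
    ring
  have f4 : 7 * δ * (p ^ 2 * m ^ 3) ≤ 7 * δ * (p ^ 2 * (s ^ 3 * lamMax u)) := by
    rw [hm, mul_pow]
    gcongr
  calc _ ≤ _ := f4
    _ = _ := f3.symm
    _ ≤ _ := f2
    _ = _ := by ring
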